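/- arXiv:2502.03216 — 2 statements merged into one kernel-verified Lean document; each statement's English description precedes it below -/
import Mathlib

section
/- Let μ₂ ∈ (0, π) denote the smallest positive solution of cot μ = (μ² − 1)/(2μ) (equivalently, of 2μ cot μ + 1 − μ² = 0). Define f : [0, μ₂] → ℝ by f(μ) = μ·√(2μ cot μ + 1 − μ²) (with f(0) = 0 by continuity). Then f(μ) > 0 for μ ∈ (0, μ₂), f(0) = f(μ₂) = 0, and f is strictly concave on (0, μ₂) (f'' < 0 there). -/
lemma aux_mul_cos_lt_sin {x : ℝ} (h0 : 0 < x) (hp : x < Real.pi) :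
    x * Real.cos x < Real.sin x := by
  have hs := Real.sin_pos_of_pos_of_lt_pi h0 hp
  by_cases h : x < Real.pi / 2
  · have hc : 0 < Real.cos x := Real.cos_pos_of_mem_Ioo ⟨by linarith, h⟩
    have := Real.lt_tan h0 h
    rwa [Real.tan_eq_sin_div_cos, lt_div_iff₀ hc] at this
  · have hc : Real.cos x ≤ 0 :=
      Real.cos_nonpos_of_pi_div_two_le_of_le (not_lt.mp h) (by linarith)
    nlinarith

/-- The expression under the root. -/
noncomputable def auxG (x : ℝ) : ℝ := 2 * x * Real.cot x + 1 - x ^ 2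

/-- Its first derivative. -/
noncomputable def auxG1 (x : ℝ) : ℝ :=
  2 * (Real.sin x * Real.cos x - x) / Real.sin x ^ 2 - 2 * x

/-- Its second derivative. -/
noncomputable def auxG2 (x : ℝ) : ℝ :=
  4 * (x * Real.cos x - Real.sin x) / Real.sin x ^ 3 - 2

lemma auxG_hasDerivAt {x : ℝ} (h0 : 0 < x) (hp : x < Real.pi) :
    HasDerivAt auxG (auxG1 x) x := by
  have hs := (Real.sin_pos_of_pos_of_lt_pi h0 hp).ne'
  have e : auxG = fun x => 2 * x * (Real.cos x / Real.sin x) + 1 - x ^ 2 := by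
    funext y; simp [auxG, Real.cot_eq_cos_div_sin]
  rw [e]
  have h := ((((hasDerivAt_id x).const_mul 2).mul
    ((Real.hasDerivAt_cos x).div (Real.hasDerivAt_sin x) hs)).add_const 1).sub
    (hasDerivAt_pow 2 x)
  refine h.congr_deriv ?_
  simp only [auxG1, id]
  have := Real.sin_sq_add_cos_sq x
  have hc : Real.cos x ^ 2 = 1 - Real.sin x ^ 2 := by linarith
  simp
  field_simp
  ring_nf
  simp only [hc]
  ring

lemma auxG1_hasDerivAt {x : ℝ} (h0 : 0 < x) (hp : x < Real.pi) :
    HasDerivAt auxG1 (auxG2 x) x := by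
  have hs := (Real.sin_pos_of_pos_of_lt_pi h0 hp).ne'
  have h := (((((Real.hasDerivAt_sin x).mul (Real.hasDerivAt_cos x)).sub
    (hasDerivAt_id x)).const_mul 2).div ((Real.hasDerivAt_sin x).pow 2)
      (pow_ne_zero 2 hs)).sub ((hasDerivAt_id x).const_mul 2)
  refine h.congr_deriv ?_
  simp only [auxG2, id]
  have := Real.sin_sq_add_cos_sq x
  have hc : Real.cos x ^ 2 = 1 - Real.sin x ^ 2 := by linarith
  simp
  field_simp
  ring_nf
  simp only [hc]
  ring

lemma auxG1_neg {x : ℝ} (h0 : 0 < x) (hp : x < Real.pi) : auxG1 x < 0 := by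
  have hs := Real.sin_pos_of_pos_of_lt_pi h0 hp
  have h1 : Real.sin x * Real.cos x - x < 0 := by
    have := Real.sin_lt (x := 2 * x) (by linarith)
    rw [Real.sin_two_mul] at this
    linarith
  have : 2 * (Real.sin x * Real.cos x - x) / Real.sin x ^ 2 < 0 :=
    div_neg_of_neg_of_pos (by linarith) (by positivity)
  unfold auxG1; linarith

lemma auxG2_neg {x : ℝ} (h0 : 0 < x) (hp : x < Real.pi) : auxG2 x < 0 := by
  have hs := Real.sin_pos_of_pos_of_lt_pi h0 hp
  have h1 := aux_mul_cos_lt_sin h0 hp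
  have : 4 * (x * Real.cos x - Real.sin x) / Real.sin x ^ 3 < 0 :=
    div_neg_of_neg_of_pos (by linarith) (by positivity)
  unfold auxG2; linarith

lemma auxG_anti : StrictAntiOn auxG (Set.Ioo 0 Real.pi) := by
  refine strictAntiOn_of_deriv_neg (convex_Ioo _ _)
    (fun x hx => (auxG_hasDerivAt hx.1 hx.2).continuousAt.continuousWithinAt) ?_
  intro x hx
  rw [interior_Ioo] at hx
  rw [(auxG_hasDerivAt hx.1 hx.2).deriv]
  exact auxG1_neg hx.1 hx.2

/-- Properties of `f(μ) = μ√(2μcot(μ) + 1 - μ²)` on `[0, μ₂]`, where `μ₂ ∈ (0, π)` is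
the smallest positive solution of `2μcot(μ) + 1 - μ² = 0`: `f > 0` on `(0, μ₂)`,
`f` vanishes at the endpoints, and `f'' < 0` on `(0, μ₂)` (strict concavity). -/
theorem stmt5 (μ₂ : ℝ) (h0 : 0 < μ₂) (hπ : μ₂ < Real.pi)
    (hz : 2 * μ₂ * Real.cot μ₂ + 1 - μ₂ ^ 2 = 0)
    (hmin : ∀ μ ∈ Set.Ioo (0 : ℝ) μ₂, 2 * μ * Real.cot μ + 1 - μ ^ 2 ≠ 0)
    (f : ℝ → ℝ)
    (hf : ∀ μ, f μ = μ * Real.sqrt (2 * μ * Real.cot μ + 1 - μ ^ 2)) :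
    (∀ μ ∈ Set.Ioo (0 : ℝ) μ₂, 0 < f μ) ∧ f 0 = 0 ∧ f μ₂ = 0 ∧
      (∀ μ ∈ Set.Ioo (0 : ℝ) μ₂, deriv (deriv f) μ < 0) ∧
      StrictConcaveOn ℝ (Set.Ioo 0 μ₂) f := by
  have hpos : ∀ x ∈ Set.Ioo (0 : ℝ) μ₂, 0 < auxG x := by
    intro x hx
    have h := auxG_anti ⟨hx.1, hx.2.trans hπ⟩ ⟨h0, hπ⟩ hx.2
    have h2 : auxG μ₂ = 0 := hz
    linarith
  have hfe : f = fun x => x * Real.sqrt (auxG x) := by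
    funext x; rw [hf]; rfl
  have hd1 : ∀ x ∈ Set.Ioo (0 : ℝ) μ₂, HasDerivAt f
      (Real.sqrt (auxG x) + x * (auxG1 x / (2 * Real.sqrt (auxG x)))) x := by
    intro x hx
    rw [hfe]
    have h := (hasDerivAt_id x).mul
      ((auxG_hasDerivAt hx.1 (hx.2.trans hπ)).sqrt (hpos x hx).ne')
    refine h.congr_deriv ?_
    simp
  have hneg : ∀ x ∈ Set.Ioo (0 : ℝ) μ₂, deriv (deriv f) x < 0 := by
    intro x hx
    have hg := hpos x hx
    have hx' := hx.2.trans hπ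
    have hev : deriv f =ᶠ[nhds x] fun x =>
        Real.sqrt (auxG x) + x * (auxG1 x / (2 * Real.sqrt (auxG x))) := by
      filter_upwards [isOpen_Ioo.mem_nhds hx] with y hy
      exact (hd1 y hy).deriv
    rw [hev.deriv_eq]
    have hs : 0 < Real.sqrt (auxG x) := Real.sqrt_pos.mpr hg
    have hq := (auxG_hasDerivAt hx.1 hx').sqrt hg.ne'
    have h := hq.add ((hasDerivAt_id x).mul ((auxG1_hasDerivAt hx.1 hx').div
      (hq.const_mul 2) (by positivity)))
    have h1 := auxG1_neg hx.1 hx'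
    have h2 := auxG2_neg hx.1 hx'
    have hx0 := hx.1
    have key := h.deriv
    refine lt_of_eq_of_lt key ?_
    simp only [id, Pi.div_apply, one_mul]
    generalize Real.sqrt (auxG x) = r at *
    generalize auxG1 x = a at *
    generalize auxG2 x = b at *
    have e1 : a / (2 * r) < 0 := div_neg_of_neg_of_pos h1 (by positivity)
    have e2 : (b * (2 * r) - a * (2 * (a / (2 * r)))) / (2 * r) ^ 2 < 0 := by
      apply div_neg_of_neg_of_pos _ (by positivity)
      have : 0 < a * (a / (2 * r)) := mul_pos_of_neg_of_neg h1 e1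
      have : b * (2 * r) < 0 := mul_neg_of_neg_of_pos h2 (by positivity)
      linarith
    have e3 := mul_neg_of_pos_of_neg hx0 e2
    linarith
  refine ⟨?_, ?_, ?_, hneg, ?_⟩
  · intro x hx
    rw [hfe]
    exact mul_pos hx.1 (Real.sqrt_pos.mpr (hpos x hx))
  · simp [hf]
  · rw [hf, hz]; simp
  · refine strictConcaveOn_of_deriv2_neg (convex_Ioo _ _)
      (fun x hx => (hd1 x hx).continuousAt.continuousWithinAt) ?_
    intro x hx
    rw [interior_Ioo] at hx
    exact hneg x hx
end

section
/- Let T ∈ 𝓛(L^∞(M, μ)) for a finite measure space (M, μ). Then T is an adjoint operator (i.e., there exists T̃ ∈ 𝓛(L¹(M, μ)) with T̃* = T) if and only if for every bounded sequence (f_n) in L^∞(M, μ) converging pointwise almost everywhere to f, the sequence T f_n converges to T f in the weak* topology of L^∞(M, μ) = (L¹(M, μ))*. -/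
open MeasureTheory Filter Topology

namespace Stmt13Aux

variable {M : Type*} [MeasurableSpace M] {μ : Measure M}

/-- Sequential continuity of a functional along bounded a.e. convergent sequences. -/
def SC (φ : Lp ℝ ⊤ μ → ℝ) : Prop :=
  ∀ (f : ℕ → Lp ℝ ⊤ μ) (f₀ : Lp ℝ ⊤ μ),
      (∃ C : ℝ, ∀ n, ‖f n‖ ≤ C) →
      (∀ᵐ x ∂μ, Tendsto (fun n => (f n) x) atTop (𝓝 (f₀ x))) →
      Tendsto (fun n => φ (f n)) atTop (𝓝 (φ f₀))

/-- The duality pairing. -/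
noncomputable def P (μ : Measure M) : Lp ℝ 1 μ →L[ℝ] Lp ℝ ⊤ μ →L[ℝ] ℝ :=
  (ContinuousLinearMap.mul ℝ ℝ).lpPairing μ 1 ⊤

lemma P_apply (g : Lp ℝ 1 μ) (f : Lp ℝ ⊤ μ) : P μ g f = ∫ x, g x * f x ∂μ := by
  simp [P, ContinuousLinearMap.lpPairing_eq_integral]

lemma ae_le (f : Lp ℝ ⊤ μ) : ∀ᵐ x ∂μ, ‖f x‖ ≤ ‖f‖ := by
  have h := enorm_ae_le_eLpNormEssSup (f : M → ℝ) μ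
  filter_upwards [h] with x hx
  rw [Lp.norm_def, eLpNorm_exponent_top]
  have h2 : eLpNormEssSup (f : M → ℝ) μ ≠ ⊤ := by
    have := Lp.eLpNorm_ne_top f
    rwa [eLpNorm_exponent_top] at this
  rw [← toReal_enorm]
  exact ENNReal.toReal_mono h2 hx

lemma norm_toLp_le [IsFiniteMeasure μ] {F : M → ℝ} (hF : MemLp F ⊤ μ) {C : ℝ} (hC : 0 ≤ C)
    (h : ∀ x, ‖F x‖ ≤ C) : ‖hF.toLp F‖ ≤ C := by
  have := Lp.norm_le_of_ae_bound (f := hF.toLp F) hC (by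
    filter_upwards [hF.coeFn_toLp] with x hx
    rw [hx]; exact h x)
  simpa using this

lemma SC_P (g : Lp ℝ 1 μ) : SC (P μ g) := by
  rintro f f₀ ⟨C, hC⟩ h
  simp only [P_apply]
  have hg : Integrable g μ := L1.integrable_coeFn g
  refine tendsto_integral_of_dominated_convergence (fun x => ‖g x‖ * C) ?_ ?_ ?_ ?_
  · intro n
    exact (Lp.aestronglyMeasurable g).mul (Lp.aestronglyMeasurable (f n))
  · exact hg.norm.mul_const C
  · intro n
    filter_upwards [ae_le (f n)] with x hx
    rw [norm_mul]
    exact mul_le_mul_of_nonneg_left (hx.trans (hC n)) (norm_nonneg _)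
  · filter_upwards [h] with x hx
    exact hx.const_mul _

lemma SC.conv [IsFiniteMeasure μ] {φ : Lp ℝ ⊤ μ → ℝ} (hφ : SC φ) {F : ℕ → M → ℝ}
    {F₀ : M → ℝ} (hF : ∀ n, MemLp (F n) ⊤ μ) (hF₀ : MemLp F₀ ⊤ μ) {C : ℝ} (hC : 0 ≤ C)
    (hb : ∀ n x, ‖F n x‖ ≤ C)
    (h : ∀ᵐ x ∂μ, Tendsto (fun n => F n x) atTop (𝓝 (F₀ x))) :
    Tendsto (fun n => φ ((hF n).toLp (F n))) atTop (𝓝 (φ (hF₀.toLp F₀))) := by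
  refine hφ _ _ ⟨C, fun n => norm_toLp_le (hF n) hC (hb n)⟩ ?_
  have h1 : ∀ᵐ x ∂μ, ∀ n, (hF n).toLp (F n) x = F n x :=
    ae_all_iff.2 fun n => (hF n).coeFn_toLp
  filter_upwards [h, h1, hF₀.coeFn_toLp] with x hx hx1 hx2
  simpa [hx1, hx2] using hx

lemma memInd [IsFiniteMeasure μ] {A : Set M} (hA : MeasurableSet A) :
    MemLp (A.indicator (fun _ => (1 : ℝ))) ⊤ μ :=
  (memLp_const (1 : ℝ)).indicator hA

/-- Indicator function as an element of `L^∞`. -/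
noncomputable def ind (μ : Measure M) [IsFiniteMeasure μ] {A : Set M} (hA : MeasurableSet A) :
    Lp ℝ ⊤ μ := (memInd hA).toLp _

lemma ind_sum [IsFiniteMeasure μ] (A : ℕ → Set M) (hA : ∀ i, MeasurableSet (A i))
    (hd : Pairwise (Function.onFun Disjoint A)) (s : Finset ℕ) :
    ∑ i ∈ s, ind μ (hA i) = ind μ (s.measurableSet_biUnion fun i _ => hA i) := by
  classical
  induction s using Finset.induction_on with
  | empty =>
    simp only [Finset.sum_empty, ind]
    symm
    rw [Lp.ext_iff]
    filter_upwards [MemLp.coeFn_toLp (memInd (μ := μ)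
      ((∅ : Finset ℕ).measurableSet_biUnion fun i _ => hA i)), Lp.coeFn_zero ℝ ⊤ μ] with x h1 h2
    rw [h1, h2]; simp
  | insert a s ha ih =>
    rw [Finset.sum_insert ha, ih]
    unfold ind
    rw [← MemLp.toLp_add]
    apply MemLp.toLp_congr
    refine Eventually.of_forall fun x => ?_
    have hdis : Disjoint (A a) (⋃ i ∈ s, A i) := by
      simp only [Set.disjoint_iUnion_right]
      intro i hi
      exact hd (fun h => ha (h ▸ hi))
    rw [Finset.set_biUnion_insert, Set.indicator_union_of_disjoint hdis]
    rfl

open Classical in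
/-- The signed measure `A ↦ φ(1_A)`. -/
noncomputable def nu [IsFiniteMeasure μ] (φ : Lp ℝ ⊤ μ →L[ℝ] ℝ) (hφ : SC φ) : SignedMeasure M where
  measureOf' A := if h : MeasurableSet A then φ (ind μ h) else 0
  empty' := by
    rw [dif_pos MeasurableSet.empty]
    have : ind μ (MeasurableSet.empty) = 0 := by
      have := ind_sum (μ := μ) (fun _ => ∅) (fun _ => MeasurableSet.empty)
        (fun i j _ => by simp [Function.onFun]) ∅
      simp only [Finset.sum_empty] at this
      rw [this]
      congr 1
      simp
    rw [this, map_zero]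
  not_measurable' A hA := dif_neg hA
  m_iUnion' A hA hd := by
    simp only [hA, dif_pos, MeasurableSet.iUnion hA]
    unfold HasSum
    rw [SummationFilter.unconditional_filter]
    refine tendsto_of_seq_tendsto fun F hF => ?_
    simp only [← map_sum]
    simp only [ind_sum A hA hd]
    refine hφ.conv (fun n => memInd ((F n).measurableSet_biUnion fun i _ => hA i))
      (memInd (MeasurableSet.iUnion hA)) zero_le_one ?_ ?_
    · intro n x
      refine (norm_indicator_le_norm_self _ _).trans ?_
      simp
    · refine Eventually.of_forall fun x => ?_
      by_cases hx : x ∈ ⋃ i, A i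
      · obtain ⟨i, hi⟩ := Set.mem_iUnion.1 hx
        refine tendsto_const_nhds.congr' ?_
        filter_upwards [hF.eventually (eventually_ge_atTop {i})] with n hn
        have : x ∈ ⋃ i ∈ F n, A i := by
          simp only [Set.mem_iUnion]
          exact ⟨i, hn (by simp), hi⟩
        rw [Set.indicator_of_mem hx, Set.indicator_of_mem this]
      · have : ∀ n, x ∉ ⋃ i ∈ F n, A i := by
          intro n h
          simp only [Set.mem_iUnion] at h hx
          obtain ⟨i, _, hi⟩ := h
          exact hx ⟨i, hi⟩
        simp [Set.indicator_of_notMem hx, Set.indicator_of_notMem (this _)]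

lemma nu_apply [IsFiniteMeasure μ] (φ : Lp ℝ ⊤ μ →L[ℝ] ℝ) (hφ : SC φ) {A : Set M}
    (hA : MeasurableSet A) : nu φ hφ A = φ (ind μ hA) := dif_pos hA

lemma exists_rep [IsFiniteMeasure μ] (φ : Lp ℝ ⊤ μ →L[ℝ] ℝ) (hφ : SC φ) :
    ∃ h : Lp ℝ 1 μ, P μ h = φ := by
  have hac : nu φ hφ ≪ᵥ μ.toENNRealVectorMeasure := by
    refine VectorMeasure.AbsolutelyContinuous.mk fun A hA h0 => ?_
    rw [Measure.toENNRealVectorMeasure_apply_measurable hA] at h0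
    rw [nu_apply φ hφ hA]
    have : ind μ hA = 0 := by
      rw [Lp.ext_iff]
      filter_upwards [MemLp.coeFn_toLp (memInd (μ := μ) hA), Lp.coeFn_zero ℝ ⊤ μ,
        measure_eq_zero_iff_ae_notMem.1 h0] with x h1 h2 h3
      rw [ind, h1, h2]; simp [h3]
    rw [this, map_zero]
  have hrn := SignedMeasure.withDensityᵥ_rnDeriv_eq (nu φ hφ) μ hac
  have hint := SignedMeasure.integrable_rnDeriv (nu φ hφ) μ
  set d := (nu φ hφ).rnDeriv μ with hd
  refine ⟨hint.toL1 d, ?_⟩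
  set h := hint.toL1 d with hh
  have hind : ∀ {A : Set M} (hA : MeasurableSet A), P μ h (ind μ hA) = φ (ind μ hA) := by
    intro A hA
    rw [← nu_apply φ hφ hA, ← hrn, withDensityᵥ_apply hint hA, P_apply,
      ← integral_indicator hA]
    apply integral_congr_ae
    filter_upwards [hint.coeFn_toL1, MemLp.coeFn_toLp (memInd (μ := μ) hA)] with x h1 h2
    rw [ind, h1, h2]
    by_cases hx : x ∈ A <;> simp [hx]
  have hsimple : ∀ (s : SimpleFunc M ℝ) (hs : MemLp s ⊤ μ),
      P μ h (hs.toLp s) = φ (hs.toLp s) := by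
    intro s
    induction s using SimpleFunc.induction with
    | const c hA =>
      intro hs
      have : hs.toLp _ = c • ind μ hA := by
        rw [ind, ← MemLp.toLp_const_smul]
        apply MemLp.toLp_congr
        refine Eventually.of_forall fun x => ?_
        simp [Set.indicator, Set.piecewise]
      rw [this, map_smul, map_smul, hind]
    | @add f g _ hf hg =>
      intro hs
      have hf' : MemLp f ⊤ μ := SimpleFunc.memLp_top f μ
      have hg' : MemLp g ⊤ μ := SimpleFunc.memLp_top g μ
      have : hs.toLp _ = hf'.toLp f + hg'.toLp g := by
        rw [← MemLp.toLp_add]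
        rfl
      rw [this, map_add, map_add, hf, hg]
  ext f
  have hsm := Lp.stronglyMeasurable f
  have hmem : ∀ n, MemLp (hsm.approxBounded ‖f‖ n) ⊤ μ := fun n => SimpleFunc.memLp_top _ μ
  have key : ∀ ψ : Lp ℝ ⊤ μ → ℝ, SC ψ →
      Tendsto (fun n => ψ ((hmem n).toLp _)) atTop (𝓝 (ψ f)) := by
    intro ψ hψ
    have := hψ.conv hmem (Lp.memLp f) (norm_nonneg f)
      (fun n x => hsm.norm_approxBounded_le (norm_nonneg f) n x)
      (hsm.tendsto_approxBounded_ae (ae_le f))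
    simpa [Lp.toLp_coeFn] using this
  have k1 := key _ (SC_P h)
  have k2 := key _ hφ
  simp only [hsimple] at k1
  exact tendsto_nhds_unique k1 k2

lemma norm_le_P [IsFiniteMeasure μ] (h : Lp ℝ 1 μ) : ‖h‖ ≤ ‖P μ h‖ := by
  have hm : Measurable (fun x => (SignType.sign (h x) : ℝ)) := by
    have := (Lp.stronglyMeasurable h).measurable
    have h2 : (fun x => (SignType.sign (h x) : ℝ)) =
      fun x => if 0 < h x then 1 else if h x < 0 then -1 else 0 := by
      funext x
      rw [sign_apply]
      split_ifs <;> simp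
    rw [h2]
    exact Measurable.ite (measurableSet_lt measurable_const this) measurable_const
      (Measurable.ite (measurableSet_lt this measurable_const) measurable_const measurable_const)
  have hb : ∀ x, ‖(SignType.sign (h x) : ℝ)‖ ≤ 1 := by
    intro x
    rcases SignType.sign (h x) with _ | _ | _ <;> simp
  have hmem : MemLp (fun x => (SignType.sign (h x) : ℝ)) ⊤ μ :=
    memLp_top_of_bound hm.aestronglyMeasurable 1 (Eventually.of_forall hb)
  have h1 : P μ h (hmem.toLp _) = ‖h‖ := by
    rw [P_apply, L1.norm_eq_integral_norm]
    apply integral_congr_ae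
    filter_upwards [hmem.coeFn_toLp] with x hx
    rw [hx, Real.norm_eq_abs, self_mul_sign]
  calc ‖h‖ = P μ h (hmem.toLp _) := h1.symm
    _ ≤ ‖P μ h (hmem.toLp _)‖ := le_abs_self _
    _ ≤ ‖P μ h‖ * ‖hmem.toLp _‖ := (P μ h).le_opNorm _
    _ ≤ ‖P μ h‖ * 1 := mul_le_mul_of_nonneg_left (norm_toLp_le hmem zero_le_one hb) (norm_nonneg _)
    _ = ‖P μ h‖ := mul_one _

lemma P_inj [IsFiniteMeasure μ] : Function.Injective (P μ) := by
  rw [injective_iff_map_eq_zero]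
  intro h hh
  have := norm_le_P h
  rw [hh, norm_zero] at this
  exact norm_le_zero_iff.1 this

end Stmt13Aux



/-- Characterization of adjoint operators on `L^∞(M, μ)`: `T ∈ 𝓛(L^∞)` is the adjoint
of some `T̃ ∈ 𝓛(L¹)` (w.r.t. the duality pairing `⟨g, f⟩ = ∫ g·f dμ`) if and only if
`T` maps bounded, a.e.-pointwise-convergent sequences to weak*-convergent sequences. -/
theorem stmt13 {M : Type*} [MeasurableSpace M] (μ : Measure M) [IsFiniteMeasure μ]
    (T : Lp ℝ ⊤ μ →L[ℝ] Lp ℝ ⊤ μ) :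
    (∃ S : Lp ℝ 1 μ →L[ℝ] Lp ℝ 1 μ, ∀ (g : Lp ℝ 1 μ) (f : Lp ℝ ⊤ μ),
        ∫ x, (S g) x * (f : Lp ℝ ⊤ μ) x ∂μ = ∫ x, g x * (T f) x ∂μ) ↔
    (∀ (f : ℕ → Lp ℝ ⊤ μ) (f₀ : Lp ℝ ⊤ μ),
      (∃ C : ℝ, ∀ n, ‖f n‖ ≤ C) →
      (∀ᵐ x ∂μ, Tendsto (fun n => (f n) x) atTop (𝓝 (f₀ x))) →
      ∀ g : Lp ℝ 1 μ,
        Tendsto (fun n => ∫ x, g x * (T (f n)) x ∂μ) atTop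
          (𝓝 (∫ x, g x * (T f₀) x ∂μ))) := by
  constructor
  · rintro ⟨S, hS⟩ f f₀ hb hf g
    simp only [← hS, ← Stmt13Aux.P_apply]
    exact Stmt13Aux.SC_P (S g) f f₀ hb hf
  · intro H
    have hex : ∀ g : Lp ℝ 1 μ, ∃ h : Lp ℝ 1 μ,
        Stmt13Aux.P μ h = (Stmt13Aux.P μ g).comp T := by
      intro g
      refine Stmt13Aux.exists_rep _ ?_
      intro f f₀ hb hf
      simpa [Stmt13Aux.P_apply] using H f f₀ hb hf g
    choose S hS using hex
    let L : Lp ℝ 1 μ →ₗ[ℝ] Lp ℝ 1 μ :=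
      { toFun := S
        map_add' := fun a b => Stmt13Aux.P_inj (by
          rw [map_add, hS, hS, hS, map_add, ContinuousLinearMap.add_comp])
        map_smul' := fun c a => Stmt13Aux.P_inj (by
          rw [map_smul, hS, hS, map_smul, ContinuousLinearMap.smul_comp]; rfl) }
    refine ⟨L.mkContinuous (‖Stmt13Aux.P μ‖ * ‖T‖) ?_, ?_⟩
    · intro g
      calc ‖S g‖ ≤ ‖Stmt13Aux.P μ (S g)‖ := Stmt13Aux.norm_le_P _
        _ = ‖(Stmt13Aux.P μ g).comp T‖ := by rw [hS]
        _ ≤ ‖Stmt13Aux.P μ g‖ * ‖T‖ := ContinuousLinearMap.opNorm_comp_le _ _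
        _ ≤ (‖Stmt13Aux.P μ‖ * ‖g‖) * ‖T‖ :=
          mul_le_mul_of_nonneg_right ((Stmt13Aux.P μ).le_opNorm g) (norm_nonneg _)
        _ = ‖Stmt13Aux.P μ‖ * ‖T‖ * ‖g‖ := by ring
    · intro g f
      have h1 := congrArg (fun φ => φ f) (hS g)
      simp only [ContinuousLinearMap.comp_apply, Stmt13Aux.P_apply] at h1
      exact h1
end
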